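/- Let R be a commutative Noetherian regular local ring of Krull dimension ℓ ≥ 2 with maximal ideal m, and let M be a finitely generated reflexive R-module such that M_p is a free R_p-module for every prime ideal p ≠ m. Then for every integer p with 1 ≤ p ≤ ℓ − 2 there is an isomorphism of R-modules Ext^{ℓ−p−1}_R(M^∨, R) ≅ Ext^ℓ_R(Ext^p_R(M, R), R). -/

import Mathlib

open CategoryTheory

/-- The `n`-th Ext group of the `R`-modules `M` and `N`. -/
noncomputable def ExtGrp (R : Type) [CommRing R] (M N : ModuleCat R) (n : ℕ) : ModuleCat R :=
  ((Ext R (ModuleCat R) n).obj (Opposite.op M)).obj N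

section Comparison

variable {R : Type} [CommRing R]

lemma smul_extMk {X Y : ModuleCat.{0} R} (P : ProjectiveResolution X) {n : ℕ}
    (f : P.complex.X n ⟶ Y) (m : ℕ) (hm : n + 1 = m)
    (hf : P.complex.d m n ≫ f = 0) (r : R) :
    r • P.extMk f m hm hf = P.extMk (r • f) m hm (by simp [hf]) := by
  rw [Abelian.Ext.smul_eq_comp_mk₀, ProjectiveResolution.extMk_comp_mk₀]
  congr 1

/-- Comparison of the two definitions of Ext. -/
lemma extGrp_iso (X Y : ModuleCat.{0} R) (n : ℕ) :
    Nonempty (ExtGrp R X Y (n + 1) ≅ ModuleCat.of R (Abelian.Ext.{0} X Y (n + 1))) := by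
  let P := projectiveResolution X
  let K := P.complex.linearYonedaObj R Y
  let S := K.sc' n (n + 1) (n + 2)
  let e1 : ExtGrp R X Y (n + 1) ≅ K.homology (n + 1) := P.isoExt (n + 1) Y
  let e2 : K.homology (n + 1) ≅ S.homology :=
    ShortComplex.homologyMapIso (K.isoSc' n (n + 1) (n + 2) (by simp) (by simp))
  let e3 := S.moduleCatHomologyIso
  have hker : ∀ x : LinearMap.ker S.g.hom,
      P.complex.d (n + 2) (n + 1) ≫ (show P.complex.X (n + 1) ⟶ Y from x.1) = 0 := by
    intro x
    exact x.2
  let φ : LinearMap.ker S.g.hom →ₗ[R] Abelian.Ext.{0} X Y (n + 1) :=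
    { toFun := fun x => P.extMk (show P.complex.X (n + 1) ⟶ Y from x.1) (n + 2) rfl (hker x)
      map_add' := fun x y => (P.add_extMk _ _ _ _ _ _).symm
      map_smul' := fun r x => (smul_extMk P _ _ _ _ r).symm }
  have hφs : Function.Surjective φ := by
    intro α
    obtain ⟨f, hf, h⟩ := P.extMk_surjective α (n + 2) rfl
    exact ⟨⟨f, hf⟩, h⟩
  have hφk : LinearMap.ker φ = LinearMap.range S.moduleCatToCycles := by
    ext x
    have := P.extMk_eq_zero_iff (show P.complex.X (n + 1) ⟶ Y from x.1) (n + 2) rfl (hker x) n rfl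
    refine this.trans ?_
    constructor
    · rintro ⟨g, hg⟩
      exact ⟨g, Subtype.ext hg⟩
    · rintro ⟨g, hg⟩
      exact ⟨g, congrArg Subtype.val hg⟩
  let e4 : (_ ⧸ LinearMap.range S.moduleCatToCycles) ≃ₗ[R] Abelian.Ext.{0} X Y (n + 1) :=
    (Submodule.quotEquivOfEq _ _ hφk.symm).trans (φ.quotKerEquivOfSurjective hφs)
  exact ⟨e1 ≪≫ e2 ≪≫ e3 ≪≫ e4.toModuleIso⟩

lemma extGrp_iso_left {X X' : ModuleCat.{0} R} (e : X ≅ X') (Y : ModuleCat.{0} R) (n : ℕ) :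
    Nonempty (ExtGrp R X Y n ≅ ExtGrp R X' Y n) :=
  ⟨(((Ext R (ModuleCat R) n).mapIso e.symm.op).app Y)⟩

end Comparison

section LES

variable {R : Type} [CommRing R]

/-- `Ext^n(A, Y)` for bare modules. -/
abbrev XT (R : Type) [CommRing R] (A : Type) [AddCommGroup A] [Module R A]
    (Y : Type) [AddCommGroup Y] [Module R Y] (n : ℕ) : Type :=
  Abelian.Ext.{0} (ModuleCat.of R A) (ModuleCat.of R Y) n

variable {A B C : Type} [AddCommGroup A] [Module R A] [AddCommGroup B] [Module R B]
  [AddCommGroup C] [Module R C] {Y : Type} [AddCommGroup Y] [Module R Y]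

lemma XT.shortExact {f : A →ₗ[R] B} {g : B →ₗ[R] C} (hf : Function.Injective f)
    (hfg : Function.Exact f g) (hg : Function.Surjective g) :
    (ModuleCat.shortComplexOfCompEqZero f g hfg.linearMap_comp_eq_zero).ShortExact :=
  ModuleCat.shortComplex_shortExact _ hfg hf hg

lemma XT.shift {f : A →ₗ[R] B} {g : B →ₗ[R] C} (hf : Function.Injective f)
    (hfg : Function.Exact f g) (hg : Function.Surjective g) (n : ℕ)
    (h0 : Subsingleton (XT R B Y n)) (h1 : Subsingleton (XT R B Y (n + 1))) :
    Nonempty (XT R A Y n ≃ₗ[R] XT R C Y (n + 1)) := by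
  have hS := XT.shortExact hf hfg hg
  refine ⟨LinearEquiv.ofBijective
    (hS.extClass.precompOfLinear R (ModuleCat.of R Y) (add_comm 1 n)) ⟨?_, ?_⟩⟩
  · rw [injective_iff_map_eq_zero]
    intro x hx
    obtain ⟨y, hy⟩ := Abelian.Ext.contravariant_sequence_exact₁ hS _ x (add_comm 1 n) hx
    have : y = 0 := h0.elim _ _
    rw [← hy, this, Abelian.Ext.comp_zero]
  · intro x
    exact Abelian.Ext.contravariant_sequence_exact₃ hS _ x (h1.elim _ _) (add_comm 1 n)

lemma XT.mid {f : A →ₗ[R] B} {g : B →ₗ[R] C} (hf : Function.Injective f)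
    (hfg : Function.Exact f g) (hg : Function.Surjective g) (n : ℕ)
    (h0 : Subsingleton (XT R C Y n)) (h1 : Subsingleton (XT R C Y (n + 1))) :
    Nonempty (XT R B Y n ≃ₗ[R] XT R A Y n) := by
  have hS := XT.shortExact hf hfg hg
  refine ⟨LinearEquiv.ofBijective
    ((Abelian.Ext.mk₀ (ModuleCat.ofHom f)).precompOfLinear R
      (ModuleCat.of R Y) (zero_add n)) ⟨?_, ?_⟩⟩
  · rw [injective_iff_map_eq_zero]
    intro x hx
    obtain ⟨y, hy⟩ := Abelian.Ext.contravariant_sequence_exact₂ hS _ x hx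
    have : y = 0 := h0.elim _ _
    rw [← hy, this, Abelian.Ext.comp_zero]
  · intro x
    exact Abelian.Ext.contravariant_sequence_exact₁ hS _ x (add_comm 1 n) (h1.elim _ _)

lemma XT.proj [Module.Projective R A] (n : ℕ) : Subsingleton (XT R A Y (n + 1)) := by
  have : Projective (ModuleCat.of R A) := ModuleCat.projective_of_categoryTheory_projective _
  exact Abelian.Ext.subsingleton_of_projective _ _ n

lemma XT.congr_left (e : A ≃ₗ[R] B) (n : ℕ) : Nonempty (XT R B Y n ≃ₗ[R] XT R A Y n) := by
  have hz : ∀ k, Subsingleton (XT R PUnit.{1} Y k) := by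
    intro k
    have : Limits.IsZero (ModuleCat.of R PUnit.{1}) := ModuleCat.isZero_of_subsingleton _
    have := this.hasProjectiveDimensionLT_zero
    exact HasProjectiveDimensionLT.subsingleton _ 0 k (by simp) _
  refine XT.mid (f := e.toLinearMap) (g := (0 : B →ₗ[R] PUnit.{1})) e.injective ?_ ?_ n (hz _) (hz _)
  · intro x
    simp
  · intro x
    exact ⟨0, rfl⟩

lemma XT.one {f : A →ₗ[R] B} {g : B →ₗ[R] C} (hf : Function.Injective f)
    (hfg : Function.Exact f g) (hg : Function.Surjective g) [Module.Projective R B] :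
    Nonempty (((A →ₗ[R] Y) ⧸ LinearMap.range (f.lcomp R Y)) ≃ₗ[R] XT R C Y 1) := by
  have hS := XT.shortExact hf hfg hg
  let ψ : (A →ₗ[R] Y) →ₗ[R] XT R C Y 1 :=
    (hS.extClass.precompOfLinear R (ModuleCat.of R Y) (add_comm 1 0)) ∘ₗ
      ((Abelian.Ext.linearEquiv₀ (R := R)).symm.toLinearMap ∘ₗ
        (ModuleCat.homLinearEquiv (S := R) (M := ModuleCat.of R A) (N := ModuleCat.of R Y)).symm.toLinearMap)
  have hψ : ∀ x, ψ x = hS.extClass.comp (Abelian.Ext.mk₀ (ModuleCat.ofHom x)) (add_comm 1 0) :=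
    fun x => rfl
  have hs : Function.Surjective ψ := by
    intro x
    obtain ⟨y, hy⟩ := Abelian.Ext.contravariant_sequence_exact₃ hS _ x
      ((XT.proj (A := B) (Y := Y) 0).elim _ _) (add_comm 1 0)
    obtain ⟨z, rfl⟩ := (Abelian.Ext.mk₀_bijective _ _).2 y
    exact ⟨z.hom, hy⟩
  have hk : LinearMap.ker ψ = LinearMap.range (f.lcomp R Y) := by
    ext x
    rw [LinearMap.mem_ker, hψ, LinearMap.mem_range]
    constructor
    · intro h
      obtain ⟨y, hy⟩ := Abelian.Ext.contravariant_sequence_exact₁ hS _ _ (add_comm 1 0) h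
      obtain ⟨z, rfl⟩ := (Abelian.Ext.mk₀_bijective _ _).2 y
      rw [Abelian.Ext.mk₀_comp_mk₀] at hy
      have := (Abelian.Ext.mk₀_bijective _ _).1 hy
      exact ⟨z.hom, congrArg ModuleCat.Hom.hom this⟩
    · rintro ⟨y, rfl⟩
      have : ModuleCat.ofHom (f.lcomp R Y y) = ModuleCat.ofHom f ≫ ModuleCat.ofHom y := rfl
      rw [this, ← Abelian.Ext.mk₀_comp_mk₀]
      rw [hS.extClass_comp_assoc]
  exact ⟨(Submodule.quotEquivOfEq _ _ hk.symm).trans (ψ.quotKerEquivOfSurjective hs)⟩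

end LES

section Main

variable {R : Type} [CommRing R]

lemma exact_lcomp {A B C : Type} [AddCommGroup A] [Module R A] [AddCommGroup B] [Module R B]
    [AddCommGroup C] [Module R C] {f : A →ₗ[R] B} {g : B →ₗ[R] C}
    (hfg : Function.Exact f g) (hg : Function.Surjective g) :
    Function.Injective (g.lcomp R R) ∧ Function.Exact (g.lcomp R R) (f.lcomp R R).rangeRestrict ∧
    Function.Surjective (f.lcomp R R).rangeRestrict := by
  refine ⟨?_, ?_, LinearMap.surjective_rangeRestrict _⟩
  · intro x y h
    ext z
    obtain ⟨w, rfl⟩ := hg z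
    exact LinearMap.congr_fun h w
  · intro x
    have h1 : (f.lcomp R R).rangeRestrict x = 0 ↔ x ∘ₗ f = 0 := by
      rw [← Subtype.coe_inj]; rfl
    rw [h1]
    constructor
    · intro h
      refine ⟨(LinearMap.range f).liftQ x ?_ ∘ₗ
        (hfg.linearEquivOfSurjective hg).symm.toLinearMap, ?_⟩
      · rintro _ ⟨y, rfl⟩
        exact LinearMap.congr_fun h y
      · ext z
        have : (hfg.linearEquivOfSurjective hg).symm (g z) = Submodule.Quotient.mk z := by
          rw [LinearEquiv.symm_apply_eq]; rfl
        simp [this]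
    · rintro ⟨y, rfl⟩
      ext z
      have := hfg.apply_apply_eq_zero z
      simp [this]

lemma exact_sub {A : Type} [AddCommGroup A] [Module R A] (B : Submodule R A) :
    Function.Exact B.subtype B.mkQ := by
  intro x
  simp

lemma dual_vanish [IsNoetherianRing R] (ℓ : ℕ)
    (hC : ∀ (N : Type) [AddCommGroup N] [Module R N] [Module.Finite R N] (j : ℕ), ℓ < j →
      Subsingleton (XT R N R j))
    (L : Type) [AddCommGroup L] [Module R L] [Module.Finite R L] (j : ℕ) (hj : ℓ < j + 3) :
    Subsingleton (XT R (Module.Dual R L) R (j + 1)) := by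
  obtain ⟨F0, _, _, _, _, f, hf⟩ := Module.exists_finite_presentation R L
  obtain ⟨F1, _, _, _, _, g, hg⟩ := Module.exists_finite_presentation R (LinearMap.ker f)
  let h : F1 →ₗ[R] F0 := (LinearMap.ker f).subtype ∘ₗ g
  have hex : Function.Exact h f := by
    rw [LinearMap.exact_iff, LinearMap.range_comp, LinearMap.range_eq_top.2 hg]
    simp
  obtain ⟨h1, h2, h3⟩ := exact_lcomp hex hf
  obtain ⟨e1⟩ := XT.shift (Y := R) (C := LinearMap.range (h.lcomp R R))
    h1 h2 h3 (j + 1)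
    (XT.proj (A := Module.Dual R F0) _) (XT.proj (A := Module.Dual R F0) _)
  obtain ⟨e2⟩ := XT.shift (Y := R) (Submodule.subtype_injective _)
    (exact_sub (LinearMap.range (h.lcomp R R))) (Submodule.mkQ_surjective _) (j + 2)
    (XT.proj (A := Module.Dual R F1) _) (XT.proj (A := Module.Dual R F1) _)
  have := hC (Module.Dual R F1 ⧸ LinearMap.range (h.lcomp R R)) (j + 3) hj
  exact (e1.trans e2).toEquiv.subsingleton

lemma main_induction [IsNoetherianRing R] (m : Ideal R) (ℓ : ℕ)
    (hC : ∀ (N : Type) [AddCommGroup N] [Module R N] [Module.Finite R N] (j : ℕ), ℓ < j →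
      Subsingleton (XT R N R j))
    (hB : ∀ (N : Type) [AddCommGroup N] [Module R N] [Module.Finite R N],
      (∃ k : ℕ, m ^ k ≤ Module.annihilator R N) → ∀ j < ℓ, Subsingleton (XT R N R j))
    (p n : ℕ) (hn : n + 1 + (p + 1) + 1 = ℓ)
    (M : Type) [AddCommGroup M] [Module R M] [Module.Finite R M]
    (hM : ∃ k : ℕ, ∀ i : ℕ, m ^ k ≤ Module.annihilator R (XT R M R (i + 1))) :
    Nonempty (XT R (Module.Dual R M) R (n + 1) ≃ₗ[R] XT R (XT R M R (p + 1)) R ℓ) := by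
  induction p generalizing n M with
  | zero =>
    obtain ⟨F, _, _, _, _, f, hf⟩ := Module.exists_finite_presentation R M
    have hex : Function.Exact (LinearMap.ker f).subtype f := by
      intro x; simp
    obtain ⟨h1, h2, h3⟩ := exact_lcomp hex hf
    obtain ⟨e1⟩ := XT.shift (Y := R) 
      (C := LinearMap.range ((LinearMap.ker f).subtype.lcomp R R)) h1 h2 h3 (n + 1)
      (XT.proj (A := Module.Dual R F) _) (XT.proj (A := Module.Dual R F) _)
    obtain ⟨e0⟩ := XT.one (Y := R) (Submodule.subtype_injective _) hex hf
    obtain ⟨e2⟩ := XT.shift (Y := R) (Submodule.subtype_injective _)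
      (exact_sub (LinearMap.range ((LinearMap.ker f).subtype.lcomp R R)))
      (Submodule.mkQ_surjective _) (n + 2)
      (dual_vanish ℓ hC _ (n + 1) (by omega)) (dual_vanish ℓ hC _ (n + 2) (by omega))
    obtain ⟨e3⟩ := XT.congr_left (Y := R) e0.symm (n + 3)
    obtain rfl : ℓ = n + 3 := by omega
    exact ⟨(e1.trans e2).trans e3⟩
  | succ p ih =>
    obtain ⟨F, _, _, _, _, f, hf⟩ := Module.exists_finite_presentation R M
    have hex : Function.Exact (LinearMap.ker f).subtype f := by
      intro x; simp
    obtain ⟨h1, h2, h3⟩ := exact_lcomp hex hf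
    obtain ⟨e1⟩ := XT.shift (Y := R) 
      (C := LinearMap.range ((LinearMap.ker f).subtype.lcomp R R)) h1 h2 h3 (n + 1)
      (XT.proj (A := Module.Dual R F) _) (XT.proj (A := Module.Dual R F) _)
    obtain ⟨e0⟩ := XT.one (Y := R) (Submodule.subtype_injective _) hex hf
    obtain ⟨k, hk⟩ := hM
    have hE := hB _ ⟨k, (hk 0).trans e0.annihilator_eq.ge⟩
    obtain ⟨e2⟩ := XT.mid (Y := R) (Submodule.subtype_injective _)
      (exact_sub (LinearMap.range ((LinearMap.ker f).subtype.lcomp R R)))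
      (Submodule.mkQ_surjective _) (n + 2)
      (hE _ (by omega)) (hE _ (by omega))
    have e3 : ∀ i, Nonempty (XT R (LinearMap.ker f) R (i + 1) ≃ₗ[R] XT R M R (i + 2)) := fun i =>
      XT.shift (Y := R) (Submodule.subtype_injective _) hex hf _ (XT.proj _) (XT.proj _)
    obtain ⟨e4⟩ := ih (n + 1) (by omega) (LinearMap.ker f) ⟨k, fun i => by
      obtain ⟨e⟩ := e3 i
      exact (hk (i + 1)).trans e.annihilator_eq.ge⟩
    obtain ⟨e5⟩ := e3 p
    obtain ⟨e6⟩ := XT.congr_left (Y := R) e5.symm ℓ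
    exact ⟨((e1.trans e2.symm).trans e4).trans e6⟩

end Main

section Punctured

variable {R : Type} [CommRing R]

/-- The ideal of scalars `r` such that `r • id` factors through `π`. -/
def splitIdeal {F M : Type} [AddCommGroup F] [Module R F] [AddCommGroup M] [Module R M]
    (π : F →ₗ[R] M) : Ideal R where
  carrier := {r | ∃ s : M →ₗ[R] F, π ∘ₗ s = r • LinearMap.id}
  zero_mem' := ⟨0, by simp⟩
  add_mem' := by
    rintro a b ⟨s, hs⟩ ⟨t, ht⟩
    exact ⟨s + t, by rw [LinearMap.comp_add, hs, ht, add_smul]⟩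
  smul_mem' := by
    rintro c a ⟨s, hs⟩
    exact ⟨c • s, by rw [LinearMap.comp_smul, hs, smul_smul, smul_eq_mul]⟩

lemma splitIdeal_le {F M : Type} [AddCommGroup F] [Module R F] [AddCommGroup M] [Module R M]
    [Module.Projective R F] (π : F →ₗ[R] M) (Y : Type) [AddCommGroup Y] [Module R Y] (i : ℕ) :
    splitIdeal π ≤ Module.annihilator R (XT R M Y (i + 1)) := by
  rintro r ⟨s, hs⟩
  rw [Module.mem_annihilator]
  intro x
  have h1 : r • x = (Abelian.Ext.mk₀ (r • 𝟙 (ModuleCat.of R M))).comp x (zero_add _) := by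
    simp [Abelian.Ext.mk₀_smul]
  have h2 : r • 𝟙 (ModuleCat.of R M) = ModuleCat.ofHom s ≫ ModuleCat.ofHom π := by
    rw [← ModuleCat.ofHom_comp, hs]; rfl
  rw [h1, h2, ← Abelian.Ext.mk₀_comp_mk₀, Abelian.Ext.comp_assoc_of_second_deg_zero]
  have : (Abelian.Ext.mk₀ (ModuleCat.ofHom π)).comp x (zero_add _) = 0 :=
    (XT.proj (A := F) (Y := Y) i).elim _ _
  rw [this, Abelian.Ext.comp_zero]

lemma splitIdeal_not_le [IsNoetherianRing R]
    {F M : Type} [AddCommGroup F] [Module R F] [AddCommGroup M] [Module R M]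
    [Module.Finite R F] [Module.Finite R M] (π : F →ₗ[R] M) (hπ : Function.Surjective π)
    (p : Ideal R) [p.IsPrime]
    (hfree : Module.Free (Localization.AtPrime p) (LocalizedModule p.primeCompl M)) :
    ¬ splitIdeal π ≤ p := by
  have : Module.FinitePresentation R M := Module.finitePresentation_of_finite R M
  let S := p.primeCompl
  let fF := LocalizedModule.mkLinearMap S F
  let fM := LocalizedModule.mkLinearMap S M
  let πp := LocalizedModule.map S π
  have hπp : Function.Surjective πp := LocalizedModule.map_surjective S π hπ
  obtain ⟨σ, hσ⟩ := Module.projective_lifting_property πp LinearMap.id hπp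
  obtain ⟨s, t, hst⟩ := Module.FinitePresentation.exists_lift_of_isLocalizedModule S fF
    ((σ.restrictScalars R) ∘ₗ fM)
  have key : fM ∘ₗ (π ∘ₗ s) = fM ∘ₗ ((t : R) • LinearMap.id) := by
    ext x
    have h1 : fF (s x) = (t : R) • σ (fM x) := LinearMap.congr_fun hst x
    have h2 : fM (π (s x)) = πp (fF (s x)) := by
      simp [fM, fF, πp, LocalizedModule.map_mk]
    have h3 : πp (σ (fM x)) = fM x := LinearMap.congr_fun hσ (fM x)
    have h4 : πp ((t : R) • σ (fM x)) = (t : R) • πp (σ (fM x)) :=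
      (πp.restrictScalars R).map_smul _ _
    simp only [LinearMap.comp_apply, LinearMap.smul_apply, LinearMap.id_apply, map_smul]
    rw [h2, h1, h4, h3]
  obtain ⟨u, hu⟩ := Module.Finite.exists_smul_of_comp_eq_of_isLocalizedModule S fM _ _ key
  intro hle
  have hmem : (u : R) * t ∈ splitIdeal π := by
    refine ⟨(u : R) • s, ?_⟩
    rw [LinearMap.comp_smul, mul_smul]
    exact hu
  rcases (inferInstance : p.IsPrime).mem_or_mem (hle hmem) with h | h
  · exact u.2 h
  · exact t.2 h

lemma punctured_annihilator [IsNoetherianRing R] [IsLocalRing R]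
    (M : Type) [AddCommGroup M] [Module R M] [Module.Finite R M]
    (hloc : ∀ (p : Ideal R) (_ : p.IsPrime), p ≠ IsLocalRing.maximalIdeal R →
      Module.Free (Localization.AtPrime p) (LocalizedModule p.primeCompl M)) :
    ∃ k : ℕ, ∀ i : ℕ,
      IsLocalRing.maximalIdeal R ^ k ≤ Module.annihilator R (XT R M R (i + 1)) := by
  obtain ⟨F, _, _, _, _, π, hπ⟩ := Module.exists_finite_presentation R M
  have h : IsLocalRing.maximalIdeal R ≤ (splitIdeal π).radical := by
    rw [Ideal.radical_eq_sInf]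
    refine le_sInf ?_
    rintro J ⟨hJ, hJp⟩
    by_cases hJm : J = IsLocalRing.maximalIdeal R
    · exact hJm.ge
    · exact absurd hJ (splitIdeal_not_le π hπ J (hloc J hJp hJm))
  obtain ⟨k, hk⟩ := Ideal.exists_pow_le_of_le_radical_of_fg h (IsNoetherian.noetherian _)
  exact ⟨k, fun i => hk.trans (splitIdeal_le π R i)⟩

end Punctured

section Regular

open IsLocalRing

lemma exists_exchange {R : Type} [CommRing R] [IsLocalRing R] {d : ℕ} (v : Fin (d + 1) → R)
    (hv : Ideal.span (Set.range v) = maximalIdeal R) (x : R) (hx : x ∈ maximalIdeal R)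
    (hx2 : x ∉ maximalIdeal R ^ 2) :
    ∃ w : Fin d → R, Ideal.span (insert x (Set.range w)) = maximalIdeal R := by
  have hvm : ∀ i, v i ∈ maximalIdeal R := fun i => hv ▸ Ideal.subset_span ⟨i, rfl⟩
  rw [← hv] at hx
  obtain ⟨c, hc⟩ := Ideal.mem_span_range_iff_exists_fun.1 hx
  have : ∃ i, c i ∉ maximalIdeal R := by
    by_contra! h
    apply hx2
    rw [← hc, pow_two]
    exact Ideal.sum_mem _ fun i _ => Ideal.mul_mem_mul (h i) (hvm i)
  obtain ⟨i, hi⟩ := this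
  have hu : IsUnit (c i) := by simpa using hi
  refine ⟨fun j => v (i.succAbove j), le_antisymm ?_ ?_⟩
  · rw [Ideal.span_le, Set.insert_subset_iff]
    refine ⟨hv ▸ hx, ?_⟩
    rintro _ ⟨j, rfl⟩
    exact hvm _
  · rw [← hv, Ideal.span_le]
    rintro _ ⟨j, rfl⟩
    have hsucc : ∀ k, v (i.succAbove k) ∈
        Ideal.span (insert x (Set.range fun j => v (i.succAbove j))) := fun k =>
      Ideal.subset_span (Set.mem_insert_of_mem _ ⟨k, rfl⟩)
    by_cases hj : j = i
    · subst hj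
      rw [SetLike.mem_coe, ← Ideal.unit_mul_mem_iff_mem _ hu]
      have : c j * v j = x - ∑ k, c (j.succAbove k) * v (j.succAbove k) := by
        rw [← hc, Fin.sum_univ_succAbove _ j]; ring
      rw [this]
      exact Ideal.sub_mem _ (Ideal.subset_span (Set.mem_insert _ _))
        (Ideal.sum_mem _ fun k _ => Ideal.mul_mem_left _ _ (hsucc k))
    · obtain ⟨k, rfl⟩ := Fin.exists_succAbove_eq hj
      exact hsucc k

lemma quot_reg {R : Type} [CommRing R] [IsLocalRing R] [IsNoetherianRing R] {d : ℕ} (x : R)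
    (w : Fin d → R) (hw : Ideal.span (insert x (Set.range w)) = maximalIdeal R)
    (hd : ((d + 1 : ℕ) : WithBot ℕ∞) ≤ ringKrullDim R) :
    ∃ _ : IsLocalRing (R ⧸ Ideal.span {x}),
      (d : WithBot ℕ∞) ≤ ringKrullDim (R ⧸ Ideal.span {x}) ∧
      Ideal.span (Set.range fun i => Ideal.Quotient.mk (Ideal.span {x}) (w i)) =
        maximalIdeal (R ⧸ Ideal.span {x}) := by
  have hxm : x ∈ maximalIdeal R := hw ▸ Ideal.subset_span (Set.mem_insert _ _)
  have hle : Ideal.span {x} ≤ maximalIdeal R := by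
    rw [Ideal.span_le]; simpa using hxm
  have hnt : Nontrivial (R ⧸ Ideal.span {x}) :=
    Ideal.Quotient.nontrivial_iff.2 fun h => (maximalIdeal.isMaximal R).ne_top (top_le_iff.1 (h ▸ hle))
  have hloc : IsLocalRing (R ⧸ Ideal.span {x}) :=
    IsLocalRing.of_surjective' (Ideal.Quotient.mk _) Ideal.Quotient.mk_surjective
  refine ⟨hloc, ?_, ?_⟩
  · have h := ringKrullDim_le_ringKrullDim_quotient_add_card ({x} : Finset R) (by
      simpa [IsLocalRing.ringJacobson_eq_maximalIdeal] using hxm)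
    have hx' : Ideal.span ((({x} : Finset R) : Set R)) = Ideal.span {x} := by simp
    rw [ringKrullDim_eq_of_ringEquiv (Ideal.quotEquivOfEq hx'), Finset.card_singleton,
      Nat.cast_one] at h
    have h2 := hd.trans h
    rw [Nat.cast_add, Nat.cast_one] at h2
    exact ENat.WithBot.add_le_add_one_right_iff.1 h2
  · have h1 : (maximalIdeal R).map (Ideal.Quotient.mk (Ideal.span {x})) =
        maximalIdeal (R ⧸ Ideal.span {x}) := by
      have hmx : ((maximalIdeal (R ⧸ Ideal.span {x})).comap
          (Ideal.Quotient.mk (Ideal.span {x}))).IsMaximal :=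
        Ideal.comap_isMaximal_of_surjective _ Ideal.Quotient.mk_surjective
      rw [← IsLocalRing.eq_maximalIdeal hmx,
        Ideal.map_comap_of_surjective _ Ideal.Quotient.mk_surjective]
    rw [← h1, ← hw, Ideal.map_span, Set.image_insert_eq, ← Set.range_comp]
    have : Ideal.Quotient.mk (Ideal.span {x}) x = 0 :=
      Ideal.Quotient.eq_zero_iff_mem.2 (Ideal.mem_span_singleton_self x)
    rw [this, Ideal.span_insert_zero]
    rfl

lemma isDomain_of_reg (d : ℕ) : ∀ (R : Type) [CommRing R] [IsLocalRing R] [IsNoetherianRing R]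
    (v : Fin d → R), Ideal.span (Set.range v) = maximalIdeal R →
    (d : WithBot ℕ∞) ≤ ringKrullDim R → IsDomain R := by
  induction d with
  | zero =>
    intro R _ _ _ v hv _
    have : maximalIdeal R = ⊥ := by rw [← hv]; simp
    have : IsField R := IsLocalRing.isField_iff_maximalIdeal_eq.2 this
    exact this.isDomain
  | succ d ih =>
    intro R _ _ _ v hv hd
    have hmin : ∀ q ∈ minimalPrimes R, ¬ maximalIdeal R ≤ q := by
      intro q hq hle
      have hqp : q.IsPrime := hq.1.1
      have hqm : q = maximalIdeal R := le_antisymm (le_maximalIdeal hqp.ne_top) hle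
      have h0 : q.height = 0 := by
        rw [Ideal.height_eq_zero_iff]
        exact hq
      rw [hqm] at h0
      have := IsLocalRing.maximalIdeal_height_eq_ringKrullDim (R := R)
      rw [h0] at this
      rw [← this] at hd
      have : ((d + 1 : ℕ) : ℕ∞) ≤ 0 := by exact_mod_cast hd
      simp at this
    have hsq : ¬ maximalIdeal R ≤ maximalIdeal R ^ 2 := by
      intro h
      have h0 : maximalIdeal R = ⊥ :=
        Submodule.eq_bot_of_le_smul_of_le_jacobson_bot (maximalIdeal R) _
          (IsNoetherian.noetherian _) (by simpa [pow_two] using h)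
          (by rw [IsLocalRing.jacobson_eq_maximalIdeal _ bot_ne_top])
      obtain ⟨q, hq⟩ := Ideal.nonempty_minimalPrimes (bot_ne_top (α := Ideal R))
      exact hmin q hq (h0 ▸ bot_le)
    obtain ⟨x, hxm, hx2, hxq⟩ : ∃ x ∈ maximalIdeal R, x ∉ maximalIdeal R ^ 2 ∧
        ∀ q ∈ minimalPrimes R, x ∉ q := by
      by_contra! hcon
      have hfin := minimalPrimes.finite_of_isNoetherianRing R
      have hsub : (maximalIdeal R : Set R) ⊆
          ⋃ i ∈ (↑(insert (maximalIdeal R ^ 2) hfin.toFinset) : Set (Ideal R)), (id i : Ideal R) := by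
        intro x hx
        simp only [Set.mem_iUnion]
        by_cases h2 : x ∈ maximalIdeal R ^ 2
        · exact ⟨_, by simp, h2⟩
        · obtain ⟨q, hq, hxq⟩ := hcon x hx h2
          exact ⟨q, by simp [hq], hxq⟩
      rw [Ideal.subset_union_prime (maximalIdeal R ^ 2) (maximalIdeal R ^ 2)] at hsub
      · obtain ⟨i, hi, hle⟩ := hsub
        rw [Finset.mem_insert] at hi
        rcases hi with rfl | hi
        · exact hsq hle
        · exact hmin i (by simpa using hi) hle
      · intro i hi hne _
        rw [Finset.mem_insert] at hi
        have hi' : i ∈ minimalPrimes R := by simpa using hi.resolve_left hne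
        exact hi'.1.1
    obtain ⟨w, hw⟩ := exists_exchange v hv x hxm hx2
    obtain ⟨hloc, hdim, hgen⟩ := quot_reg x w hw hd
    have hdom := ih _ _ hgen hdim
    have hprime : (Ideal.span {x}).IsPrime := (Ideal.Quotient.isDomain_iff_prime _).1 hdom
    obtain ⟨q, hq, hqx⟩ := Ideal.exists_minimalPrimes_le (bot_le : ⊥ ≤ Ideal.span {x})
    have hqp : q.IsPrime := hq.1.1
    have hq0 : q = ⊥ := by
      refine Submodule.eq_bot_of_le_smul_of_le_jacobson_bot (maximalIdeal R) _
          (IsNoetherian.noetherian _) ?_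
          (by rw [IsLocalRing.jacobson_eq_maximalIdeal _ bot_ne_top])
      intro y hy
      obtain ⟨a, rfl⟩ := Ideal.mem_span_singleton'.1 (hqx hy)
      have ha : a ∈ q := (hqp.mem_or_mem hy).resolve_right (hxq q hq)
      rw [mul_comm]
      exact Ideal.mul_mem_mul hxm ha
    rw [hq0] at hqp
    exact IsDomain.of_bot_isPrime R

end Regular

section Regular2

open IsLocalRing RingTheory.Sequence Pointwise

lemma isRegular_of_reg (d : ℕ) : ∀ (R : Type) [CommRing R] [IsLocalRing R] [IsNoetherianRing R]
    (v : Fin d → R), Ideal.span (Set.range v) = maximalIdeal R →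
    (d : WithBot ℕ∞) ≤ ringKrullDim R → IsRegular R (List.ofFn v) := by
  induction d with
  | zero =>
    intro R _ _ _ v hv _
    simpa using RingTheory.Sequence.IsRegular.nil R R
  | succ d ih =>
    intro R _ _ _ v hv hd
    have hdom := isDomain_of_reg _ R v hv hd
    have hw : Ideal.span (insert (v 0) (Set.range fun i : Fin d => v i.succ)) =
        maximalIdeal R := by
      rw [← hv]
      congr 1
      ext y
      simp [Fin.exists_fin_succ, eq_comm]
    have h0 : v 0 ≠ 0 := by
      intro h0
      rw [h0, Ideal.span_insert_zero] at hw
      have h1 : (maximalIdeal R).height ≤ d := by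
        rw [← hw]
        refine (Ideal.height_le_spanFinrank _ ?_).trans ?_
        · rw [hw]; exact (maximalIdeal.isMaximal R).ne_top
        · have h2 := Submodule.spanFinrank_span_le_ncard_of_finite
            (R := R) (Set.finite_range fun i : Fin d => v i.succ)
          have h3 : (Set.range fun i : Fin d => v i.succ).ncard ≤ d := by
            rw [← Set.image_univ]
            refine (Set.ncard_image_le Set.finite_univ).trans ?_
            simp
          exact_mod_cast h2.trans h3
      rw [← IsLocalRing.maximalIdeal_height_eq_ringKrullDim] at hd
      have h2 : ((d + 1 : ℕ) : ℕ∞) ≤ (maximalIdeal R).height := by exact_mod_cast hd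
      have h3 : ((d + 1 : ℕ) : ℕ∞) ≤ d := h2.trans h1
      have : d + 1 ≤ d := by exact_mod_cast h3
      omega
    obtain ⟨hloc, hdim, hgen⟩ := quot_reg (v 0) _ hw hd
    have := ih _ _ hgen hdim
    rw [List.ofFn_succ, isRegular_cons_iff']
    refine ⟨?_, ?_⟩
    · intro a b hab
      exact mul_left_cancel₀ h0 hab
    · have he : List.map (Ideal.Quotient.mk (Ideal.span {v 0})) (List.ofFn fun i => v i.succ) =
        List.ofFn fun i : Fin d => Ideal.Quotient.mk (Ideal.span {v 0}) (v i.succ) := by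
        simp [List.map_ofFn, Function.comp_def]
      rw [he]
      have hs : (v 0 • (⊤ : Submodule R R)) = Ideal.span {v 0} := by
        rw [← Submodule.ideal_span_singleton_smul]; simp
      let e := Submodule.quotEquivOfEq _ _ hs
      let e' : QuotSMulTop (v 0) R ≃ₗ[R ⧸ Ideal.span {v 0}] (R ⧸ Ideal.span {v 0}) :=
        { e with
          map_smul' := by
            intro a y
            obtain ⟨a, rfl⟩ := Ideal.Quotient.mk_surjective a
            exact e.map_smul a y }
      exact (e'.isRegular_congr _).2 this

end Regular2
section Vanish

open IsLocalRing RingTheory.Sequence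

variable {R : Type} [CommRing R] [IsLocalRing R] [IsNoetherianRing R]

lemma XT.sub_mid {A B C : Type} [AddCommGroup A] [Module R A] [AddCommGroup B] [Module R B]
    [AddCommGroup C] [Module R C] {Y : Type} [AddCommGroup Y] [Module R Y]
    {f : A →ₗ[R] B} {g : B →ₗ[R] C} (hf : Function.Injective f)
    (hfg : Function.Exact f g) (hg : Function.Surjective g) (n : ℕ)
    (h0 : Subsingleton (XT R A Y n)) (h1 : Subsingleton (XT R C Y n)) :
    Subsingleton (XT R B Y n) := by
  have hS := XT.shortExact hf hfg hg
  refine subsingleton_of_forall_eq 0 fun x => ?_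
  obtain ⟨y, hy⟩ := Abelian.Ext.contravariant_sequence_exact₂ hS _ x (h0.elim _ _)
  have : y = 0 := h1.elim _ _
  rw [← hy, this, Abelian.Ext.comp_zero]

lemma XT.zero_of_regular {B : Type} [AddCommGroup B] [Module R B] [Module.Finite R B]
    {C : Type} [AddCommGroup C] [Module R C]
    (x : R) (hx : x ∈ maximalIdeal R) (hreg : IsSMulRegular B x) (g : B →ₗ[R] C)
    (hg : Function.Surjective g) (hfg : Function.Exact (x • (LinearMap.id : B →ₗ[R] B)) g)
    (n : ℕ) (h : Subsingleton (XT R C R (n + 1))) : Subsingleton (XT R B R n) := by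
  have hS := XT.shortExact (f := x • (LinearMap.id : B →ₗ[R] B)) (fun a b hab => hreg hab) hfg hg
  have hfin : Module.Finite R (XT R B R n) := ModuleCat.finite_ext R _ _ n
  have hle : (⊤ : Submodule R (XT R B R n)) ≤ maximalIdeal R • ⊤ := by
    intro z _
    obtain ⟨y, hy⟩ := Abelian.Ext.contravariant_sequence_exact₁ hS _ z (add_comm 1 n) (h.elim _ _)
    have : z = x • y := by
      rw [← hy]
      have h1 := Abelian.Ext.smul_comp (R := R) (Abelian.Ext.mk₀ (𝟙 (ModuleCat.of R B))) y
        (zero_add n) x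
      rw [Abelian.Ext.mk₀_id_comp, ← Abelian.Ext.mk₀_smul] at h1
      exact h1
    rw [this]
    exact Submodule.smul_mem_smul hx trivial
  have := Submodule.eq_bot_of_le_smul_of_le_jacobson_bot (maximalIdeal R) _ hfin.1 hle
    (by rw [IsLocalRing.jacobson_eq_maximalIdeal _ bot_ne_top])
  exact (Submodule.subsingleton_iff R).1 (subsingleton_of_bot_eq_top this.symm)

lemma vanish_residue (rs : List R) (hrs : IsRegular R rs) (hm : Ideal.ofList rs = maximalIdeal R)
    (j : ℕ) (hj : rs.length < j) : Subsingleton (XT R (R ⧸ maximalIdeal R) R j) := by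
  have h := ModuleCat.projectiveDimension_quotient_eq_length.{0} rs hrs
  have h2 := (projectiveDimension_le_iff _ rs.length).1 h.le
  obtain ⟨e⟩ := XT.congr_left (R := R) (Y := R)
    ((Shrink.linearEquiv R (R ⧸ Ideal.ofList rs)).trans
      (Submodule.quotEquivOfEq _ _ hm) : Shrink.{0} (R ⧸ Ideal.ofList rs) ≃ₗ[R] _) j
  have h3 : Subsingleton (XT R (Shrink.{0} (R ⧸ Ideal.ofList rs)) R j) :=
    HasProjectiveDimensionLT.subsingleton _ (rs.length + 1) j hj _
  exact e.toEquiv.subsingleton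

lemma vanish_all (ℓ : ℕ)
    (h : ∀ j, ℓ < j → Subsingleton (XT R (R ⧸ maximalIdeal R) R j)) (I : Ideal R) :
    ∀ (N : Type) [AddCommGroup N] [Module R N] [Module.Finite R N],
      I ≤ Module.annihilator R N → ∀ j, ℓ < j → Subsingleton (XT R N R j) := by
  induction I using IsNoetherian.induction with
  | hgt I ih =>
  intro N _ _ hN
  induction hN using IsNoetherianRing.induction_on_isQuotientEquivQuotientPrime R with
  | subsingleton N =>
    intro _ j hj
    have : Limits.IsZero (ModuleCat.of R N) := ModuleCat.isZero_of_subsingleton _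
    have := this.hasProjectiveDimensionLT_zero
    exact HasProjectiveDimensionLT.subsingleton _ 0 j (by simp) _
  | quotient N p e =>
    intro hI j hj
    rw [e.annihilator_eq, Ideal.annihilator_quotient] at hI
    obtain ⟨e'⟩ := XT.congr_left (R := R) (Y := R) e j
    suffices hs : Subsingleton (XT R (R ⧸ p.1) R j) from e'.symm.toEquiv.subsingleton
    by_cases hpm : p.1 = maximalIdeal R
    · obtain ⟨e2⟩ := XT.congr_left (R := R) (Y := R) (Submodule.quotEquivOfEq _ _ hpm) j
      have := h j hj
      exact e2.symm.toEquiv.subsingleton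
    · have hp := p.2
      obtain ⟨x, hxm, hxp⟩ : ∃ x ∈ maximalIdeal R, x ∉ p.1 := by
        by_contra! hc
        exact hpm (le_antisymm (le_maximalIdeal hp.ne_top) hc)
      have hreg : IsSMulRegular (R ⧸ p.1) x := by
        refine isSMulRegular_iff_right_eq_zero_of_smul.2 ?_
        intro y hy
        obtain ⟨y, rfl⟩ := Ideal.Quotient.mk_surjective y
        rw [Algebra.smul_def, Ideal.Quotient.algebraMap_eq, ← map_mul,
          Ideal.Quotient.eq_zero_iff_mem] at hy
        exact Ideal.Quotient.eq_zero_iff_mem.2 ((hp.mem_or_mem hy).resolve_left hxp)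
      refine XT.zero_of_regular x hxm hreg
        (LinearMap.range (x • (LinearMap.id : (R ⧸ p.1) →ₗ[R] (R ⧸ p.1)))).mkQ
        (Submodule.mkQ_surjective _) (LinearMap.exact_map_mkQ_range _) j ?_
      refine ih (I ⊔ Ideal.span {x}) ?_ _ ?_ (j + 1) (by omega)
      · refine lt_of_le_of_ne le_sup_left fun heq => hxp (hI ?_)
        rw [heq]
        exact Ideal.mem_sup_right (Ideal.mem_span_singleton_self x)
      · rw [sup_le_iff, Ideal.span_singleton_le_iff_mem]
        constructor
        · intro a ha
          rw [Module.mem_annihilator]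
          intro y
          obtain ⟨y, rfl⟩ := Submodule.mkQ_surjective _ y
          obtain ⟨y, rfl⟩ := Ideal.Quotient.mk_surjective y
          have h0 : a • Ideal.Quotient.mk p.1 y = 0 := by
            rw [Algebra.smul_def, Ideal.Quotient.algebraMap_eq,
              Ideal.Quotient.eq_zero_iff_mem.2 (hI ha), zero_mul]
          rw [← map_smul, h0, map_zero]
        · rw [Module.mem_annihilator]
          intro y
          obtain ⟨y, rfl⟩ := Submodule.mkQ_surjective _ y
          rw [← map_smul]
          exact (Submodule.Quotient.mk_eq_zero _).2 ⟨y, rfl⟩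
  | exact N₁ N₂ N₃ f g hf hg hfg h1 h3 =>
    intro hI j hj
    exact XT.sub_mid hf hfg hg j
      (h1 (hI.trans (LinearMap.annihilator_le_of_injective f hf)) j hj)
      (h3 (hI.trans (LinearMap.annihilator_le_of_surjective g hg)) j hj)

lemma vanish_low (rs : List R) (hrs : IsRegular R rs) (hm : ∀ r ∈ rs, r ∈ maximalIdeal R)
    (N : Type) [AddCommGroup N] [Module R N] [Module.Finite R N]
    (hN : ∃ k, maximalIdeal R ^ k ≤ Module.annihilator R N) (j : ℕ) (hj : j < rs.length) :
    Subsingleton (XT R N R j) := by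
  obtain ⟨k, hk⟩ := hN
  refine ModuleCat.subsingleton_ext_of_exists_isRegular (maximalIdeal R) (ModuleCat.of R N) ?_
    (ModuleCat.of R R) ?_ rs hm hrs j hj
  · change Module.support R N ⊆ _
    rw [Module.support_eq_zeroLocus, PrimeSpectrum.zeroLocus_subset_zeroLocus_iff]
    intro x hx
    exact ⟨k, hk (Ideal.pow_mem_pow hx k)⟩
  · change maximalIdeal R • (⊤ : Ideal R) < ⊤
    simpa using lt_top_iff_ne_top.2 (maximalIdeal.isMaximal R).ne_top

end Vanish

/-- Let `R` be a commutative Noetherian regular local ring of Krull dimension `ℓ ≥ 2` with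
maximal ideal `m`, and `M` a finitely generated reflexive `R`-module which is free at every
prime `p ≠ m`.  Then for `1 ≤ p ≤ ℓ - 2` there are isomorphisms
`Ext^{ℓ-p-1}_R(M^∨, R) ≅ Ext^ℓ_R(Ext^p_R(M, R), R)`. -/
theorem ext_dual_iso_ext_ext (R : Type) [CommRing R] [IsNoetherianRing R] [IsLocalRing R]
    (ℓ : ℕ) (hl : 2 ≤ ℓ)
    (hdim : ringKrullDim R = ℓ)
    (hreg : ∃ s : Finset R, s.card = ℓ ∧ Ideal.span (s : Set R) = IsLocalRing.maximalIdeal R)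
    (M : Type) [AddCommGroup M] [Module R M] [Module.Finite R M]
    (hrefl : Module.IsReflexive R M)
    (hloc : ∀ (p : Ideal R) (_ : p.IsPrime), p ≠ IsLocalRing.maximalIdeal R →
      Module.Free (Localization.AtPrime p) (LocalizedModule p.primeCompl M)) :
    ∀ p : ℕ, 1 ≤ p → p ≤ ℓ - 2 →
      Nonempty (ExtGrp R (ModuleCat.of R (Module.Dual R M)) (ModuleCat.of R R) (ℓ - p - 1) ≅
        ExtGrp R (ExtGrp R (ModuleCat.of R M) (ModuleCat.of R R) p) (ModuleCat.of R R) ℓ) := by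
  intro q hq1 hq2
  obtain ⟨s, hs, hspan⟩ := hreg
  let v : Fin ℓ → R := fun i => (s.equivFin.symm (Fin.cast hs.symm i) : R)
  have hrange : Set.range v = (s : Set R) := by
    ext y
    constructor
    · rintro ⟨i, rfl⟩
      exact (s.equivFin.symm (Fin.cast hs.symm i)).2
    · intro hy
      exact ⟨Fin.cast hs (s.equivFin ⟨y, hy⟩), by simp [v]⟩
  have hv : Ideal.span (Set.range v) = IsLocalRing.maximalIdeal R := by rw [hrange, hspan]
  have hrs := isRegular_of_reg ℓ R v hv hdim.ge
  have hof : Ideal.ofList (List.ofFn v) = IsLocalRing.maximalIdeal R := by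
    rw [← hv, Ideal.ofList]
    congr 1
    ext y
    simp [List.mem_ofFn]
  have hmem : ∀ r ∈ List.ofFn v, r ∈ IsLocalRing.maximalIdeal R := by
    intro r hr
    rw [← hof]
    exact Ideal.subset_span hr
  obtain ⟨p, rfl⟩ : ∃ p, q = p + 1 := ⟨q - 1, by omega⟩
  obtain ⟨n, hn⟩ : ∃ n, n + 1 + (p + 1) + 1 = ℓ := ⟨ℓ - p - 3, by omega⟩
  have hdeg : ℓ - (p + 1) - 1 = n + 1 := by omega
  obtain ⟨k, hk⟩ : ∃ k, ℓ = k + 1 := ⟨ℓ - 1, by omega⟩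
  obtain ⟨e⟩ := main_induction (IsLocalRing.maximalIdeal R) ℓ
    (fun N _ _ _ j hj => vanish_all ℓ (fun j hj => vanish_residue (List.ofFn v) hrs hof j
      (by simpa using hj)) ⊥ N bot_le j hj)
    (fun N _ _ _ hN j hj => vanish_low (List.ofFn v) hrs hmem N hN j (by simpa using hj))
    p n hn M (punctured_annihilator M hloc)
  rw [hdeg]
  obtain ⟨e1⟩ := extGrp_iso (ModuleCat.of R (Module.Dual R M)) (ModuleCat.of R R) n
  obtain ⟨e2⟩ := extGrp_iso (ModuleCat.of R M) (ModuleCat.of R R) p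
  obtain ⟨e3⟩ := extGrp_iso_left e2 (ModuleCat.of R R) ℓ
  have e4 : Nonempty (ExtGrp R (ModuleCat.of R (XT R M R (p + 1))) (ModuleCat.of R R) ℓ ≅
      ModuleCat.of R (XT R (XT R M R (p + 1)) R ℓ)) := by
    rw [hk]
    exact extGrp_iso _ _ k
  obtain ⟨e4⟩ := e4
  exact ⟨e1 ≪≫ e.toModuleIso ≪≫ e4.symm ≪≫ e3.symm⟩
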